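/- arXiv:1809.05980 — 3 statements merged into one kernel-verified Lean document; each statement's English description precedes it below -/
import Mathlib

section
/- Let I and J be finite index sets, let a : I → ℤ and c : J → ℤ be families of integers, and let b : I → ℤ and d : J → ℤ be families of positive integers. If for every pair (i, j) ∈ I × J one has a i · d j − b i · c j ≥ (b i − 1) · (d j − 1), then there exists an integer n satisfying b i · n ≤ a i for every i ∈ I (i.e. n ≤ a i / b i) and d j · n ≥ c j for every j ∈ J (i.e. n ≥ c j / d j). -/
/-- A single pair of bounds: the integer part of the upper bound satisfies the lower bound. -/
theorem le_mul_ediv_of_sub_one_mul_sub_one_le {a b c d : ℤ} (hb : 0 < b) (hd : 0 < d)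
    (h : (b - 1) * (d - 1) ≤ a * d - b * c) : c ≤ d * (a / b) := by
  by_contra! hc
  have ha : a + 1 ≤ b * (a / b) + b := Int.lt_mul_ediv_self_add hb
  have hc' : d * (a / b) + 1 ≤ c := hc
  nlinarith [mul_le_mul_of_nonneg_right ha hd.le, mul_le_mul_of_nonneg_left hc' hb.le]

/-- Integer variable elimination: if all cross-differences
`a i * d j - b i * c j` are at least `(b i - 1) * (d j - 1)` (with positive
integer denominators `b i`, `d j`), then some integer `n` satisfies
`b i * n ≤ a i` (i.e. `n ≤ a i / b i`) for all `i` and `d j * n ≥ c j`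
(i.e. `n ≥ c j / d j`) for all `j`. -/
theorem int_variable_elimination {I J : Type*} [Fintype I] [Fintype J]
    (a : I → ℤ) (c : J → ℤ) (b : I → ℤ) (d : J → ℤ)
    (hb : ∀ i, 0 < b i) (hd : ∀ j, 0 < d j)
    (h : ∀ i j, a i * d j - b i * c j ≥ (b i - 1) * (d j - 1)) :
    ∃ n : ℤ, (∀ i, b i * n ≤ a i) ∧ (∀ j, c j ≤ d j * n) := by
  rcases isEmpty_or_nonempty I with hI | hI
  · refine ⟨∑ j, |c j|, fun i => isEmptyElim i, fun j => ?_⟩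
    have hj : |c j| ≤ ∑ j, |c j| :=
      Finset.single_le_sum (fun k _ => abs_nonneg (c k)) (Finset.mem_univ j)
    nlinarith [le_abs_self (c j), abs_nonneg (c j), hd j]
  · obtain ⟨i₀, hi₀⟩ := Finite.exists_min fun i => a i / b i
    refine ⟨a i₀ / b i₀, fun i => ?_, fun j =>
      le_mul_ediv_of_sub_one_mul_sub_one_le (hb i₀) (hd j) (h i₀ j)⟩
    exact (mul_le_mul_of_nonneg_left (hi₀ i) (hb i).le).trans (Int.mul_ediv_self_le (hb i).ne')
end

section
/- Let a and c be integers and let b and d be positive integers. If a · d − b · c ≥ (b − 1) · (d − 1), then there exists an integer n with b · n ≤ a and d · n ≥ c; equivalently, the ceiling of c / d is at most the floor of a / b. -/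
/-- Single-pair integer variable elimination: if `a * d - b * c ≥ (b - 1) * (d - 1)`
with `b, d > 0`, then there is an integer `n` with `b * n ≤ a` and `d * n ≥ c`;
equivalently, the ceiling of `c / d` is at most the floor of `a / b`. -/
theorem int_variable_elimination_single (a c b d : ℤ) (hb : 0 < b) (hd : 0 < d)
    (h : a * d - b * c ≥ (b - 1) * (d - 1)) :
    (∃ n : ℤ, b * n ≤ a ∧ c ≤ d * n) ∧ ⌈(c : ℚ) / (d : ℚ)⌉ ≤ ⌊(a : ℚ) / (b : ℚ)⌋ := by
  have hn : ∃ n : ℤ, b * n ≤ a ∧ c ≤ d * n := by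
    refine ⟨a / b, Int.mul_ediv_self_le hb.ne', ?_⟩
    by_contra! hc
    have ha : a + 1 ≤ b * (a / b) + b := Int.lt_mul_ediv_self_add hb
    have had := mul_le_mul_of_nonneg_right ha hd.le
    have hbc := mul_le_mul_of_nonneg_left (Int.add_one_le_of_lt hc) hb.le
    linarith
  refine ⟨hn, ?_⟩
  obtain ⟨n, hna, hcn⟩ := hn
  have hb' : (0 : ℚ) < b := by exact_mod_cast hb
  have hd' : (0 : ℚ) < d := by exact_mod_cast hd
  refine le_trans (b := n) (Int.ceil_le.2 ?_) (Int.le_floor.2 ?_)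
  · rw [div_le_iff₀' hd']
    exact_mod_cast hcn
  · rw [le_div_iff₀' hb']
    exact_mod_cast hna
end

section
/- Let V be a nonempty finite subset of ℝⁿ, let P be the convex hull of V (a compact convex polytope), and let C₁ and C₂ be closed convex subsets of ℝⁿ. Call a point v a vertex of P if v is an extreme point of P, and call a segment [v, w] between distinct vertices v and w an edge of P if the segment [v, w] is an extreme subset (face) of P. Then P ⊆ C₁ ∪ C₂ if and only if: (a) every vertex of P is contained in C₁ or in C₂; and (b) for every edge [v, w] of P with v ∉ C₁ and w ∉ C₂, the segment [v, w] meets C₁ ∩ C₂. -/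
section FacialDirections

variable {E : Type*} [AddCommGroup E] [Module ℝ E]

/-- The directions in which one can move from `x` both forwards and backwards inside the convex
set `P`; this is the direction of the smallest face of `P` containing `x`. -/
def facialDirections {P : Set E} (hP : Convex ℝ P) {x : E} (hx : x ∈ P) : Submodule ℝ E where
  carrier := {d | ∃ ε : ℝ, 0 < ε ∧ x + ε • d ∈ P ∧ x - ε • d ∈ P}
  zero_mem' := ⟨1, one_pos, by simpa using hx, by simpa using hx⟩
  add_mem' := by
    rintro d e ⟨ε, hε, h₁, h₂⟩ ⟨δ, hδ, h₃, h₄⟩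
    have hs : ε + δ ≠ 0 := by positivity
    refine ⟨ε * δ / (ε + δ), by positivity, ?_, ?_⟩
    · convert hP h₁ h₃ (a := δ / (ε + δ)) (b := ε / (ε + δ)) (by positivity) (by positivity)
        (by field_simp; ring) using 1
      match_scalars <;> field_simp
      ring
    · convert hP h₂ h₄ (a := δ / (ε + δ)) (b := ε / (ε + δ)) (by positivity) (by positivity)
        (by field_simp; ring) using 1
      match_scalars <;> field_simp
      ring
  smul_mem' := by
    rintro c d ⟨ε, hε, h₁, h₂⟩
    rcases lt_trichotomy c 0 with hc | rfl | hc
    · have hc0 : c ≠ 0 := hc.ne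
      refine ⟨ε / (-c), div_pos hε (neg_pos.2 hc), ?_, ?_⟩
      · convert h₂ using 1
        match_scalars <;> field_simp
      · convert h₁ using 1
        match_scalars <;> field_simp
    · exact ⟨1, one_pos, by simpa using hx, by simpa using hx⟩
    · refine ⟨ε / c, by positivity, ?_, ?_⟩
      · convert h₁ using 1
        match_scalars <;> field_simp
      · convert h₂ using 1
        match_scalars <;> field_simp

theorem facialDirections_le {P : Set E} (hP : Convex ℝ P) {x y p : E} (hx : x ∈ P) (hy : y ∈ P)
    (hp : p ∈ P) {a b : ℝ} (ha : 0 < a) (hb : 0 ≤ b) (hab : a + b = 1)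
    (hxy : x = a • y + b • p) : facialDirections hP hy ≤ facialDirections hP hx := by
  rintro d ⟨ε, hε, h₁, h₂⟩
  refine ⟨a * ε, by positivity, ?_, ?_⟩
  · convert hP h₁ hp ha.le hb hab using 1
    rw [hxy]
    module
  · convert hP h₂ hp ha.le hb hab using 1
    rw [hxy]
    module

theorem sub_mem_facialDirections {P : Set E} (hP : Convex ℝ P) {x a b : E} (hx : x ∈ P)
    (ha : a ∈ P) (hb : b ∈ P) (hxab : x ∈ openSegment ℝ a b) :
    a - x ∈ facialDirections hP hx := by
  obtain ⟨s, t, hs, ht, hst, rfl⟩ := hxab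
  obtain rfl : s = 1 - t := by linarith
  refine ⟨1 - t, hs, ?_, ?_⟩
  · convert hP ha hb (a := 1 - t * t) (b := t * t) (by nlinarith) (by positivity) (by ring) using 1
    module
  · convert hP ha hb (a := (1 - t) * (1 - t)) (b := 1 - (1 - t) * (1 - t)) (by positivity)
      (by nlinarith) (by ring) using 1
    module

/-- A point of `P` with no facial direction is an extreme point. -/
theorem mem_extremePoints_of_facialDirections_eq_bot {P : Set E} (hP : Convex ℝ P) {x : E}
    (hx : x ∈ P) (h : facialDirections hP hx = ⊥) : x ∈ P.extremePoints ℝ := by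
  refine ⟨hx, fun a ha b hb hxab => ?_⟩
  have := sub_mem_facialDirections hP hx ha hb hxab
  rw [h, Submodule.mem_bot] at this
  exact sub_eq_zero.1 this

end FacialDirections

section Compact

variable {E : Type*} [NormedAddCommGroup E] [NormedSpace ℝ E]

theorem exists_isGreatest_add_smul_mem {P : Set E} (hP : IsCompact P) {x d : E} (hx : x ∈ P)
    (hd : d ≠ 0) : ∃ t : ℝ, IsGreatest {t : ℝ | x + t • d ∈ P} t := by
  have hclosed : IsClosed {t : ℝ | x + t • d ∈ P} :=
    hP.isClosed.preimage (f := fun t : ℝ => x + t • d) (by fun_prop)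
  obtain ⟨M, hM⟩ := hP.isBounded.exists_norm_le
  have hd' : 0 < ‖d‖ := norm_pos_iff.2 hd
  have hbdd : BddAbove {t : ℝ | x + t • d ∈ P} := by
    refine ⟨(M + ‖x‖) / ‖d‖, fun t ht => ?_⟩
    rw [le_div_iff₀ hd']
    calc t * ‖d‖ ≤ |t| * ‖d‖ := by gcongr; exact le_abs_self t
      _ = ‖(x + t • d) - x‖ := by rw [add_sub_cancel_left, norm_smul, Real.norm_eq_abs]
      _ ≤ ‖x + t • d‖ + ‖x‖ := norm_sub_le _ _
      _ ≤ M + ‖x‖ := by gcongr; exact hM _ ht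
  exact ⟨_, hclosed.csSup_mem ⟨0, by simpa using hx⟩ hbdd, fun t ht => le_csSup hbdd ht⟩

/-- Moving from `x` as far as possible along a facial direction `d` leads to a smaller face. -/
theorem exists_endpoint {P : Set E} (hP : Convex ℝ P) (hPc : IsCompact P) {x d : E} (hx : x ∈ P)
    (hd : d ≠ 0) (hdx : d ∈ facialDirections hP hx) :
    ∃ t : ℝ, 0 < t ∧ (∀ s, x + s • d ∈ P → s ≤ t) ∧ ∃ hy : x + t • d ∈ P,
      facialDirections hP hy ≤ facialDirections hP hx ∧ d ∉ facialDirections hP hy := by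
  obtain ⟨t, hy, ht⟩ := exists_isGreatest_add_smul_mem hPc hx hd
  obtain ⟨ε, hε, h₁, h₂⟩ := hdx
  have htpos : 0 < t := hε.trans_le (ht h₁)
  refine ⟨t, htpos, fun s hs => ht hs, hy, ?_, ?_⟩
  · refine facialDirections_le hP hx hy h₂ (a := ε / (ε + t)) (b := t / (ε + t)) (by positivity)
      (by positivity) (by field_simp) ?_
    match_scalars <;> field_simp
    ring
  · rintro ⟨δ, hδ, h₃, -⟩
    have : t + δ ≤ t := ht (by simpa only [Set.mem_ofPred_eq, add_smul, add_assoc] using h₃)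
    linarith

theorem exists_nonneg_direction (S : Submodule ℝ E) [FiniteDimensional ℝ S]
    (hS : 2 ≤ Module.finrank ℝ S) (f g : E →ₗ[ℝ] ℝ) :
    ∃ d ∈ S, d ≠ 0 ∧ 0 ≤ f d ∧ 0 ≤ g d := by
  obtain ⟨⟨d, hdS⟩, hd, hd0⟩ : ∃ d ∈ LinearMap.ker (f ∘ₗ S.subtype), d ≠ 0 :=
    Submodule.exists_mem_ne_zero_of_ne_bot <|
      LinearMap.ker_ne_bot_of_finrank_lt (by rw [Module.finrank_self]; omega)
  have hfd : f d = 0 := by simpa using hd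
  have hd0' : d ≠ 0 := fun h => hd0 (by simpa using h)
  rcases le_total 0 (g d) with h | h
  · exact ⟨d, hdS, hd0', hfd.ge, h⟩
  · exact ⟨-d, S.neg_mem hdS, neg_ne_zero.2 hd0', by simp [hfd], by simpa using h⟩

/-- A point of `P` whose facial directions form a line lies in the interior of an edge. -/
theorem exists_edge {P : Set E} (hP : Convex ℝ P) (hPc : IsCompact P) {x d : E} (hx : x ∈ P)
    (hd : d ≠ 0) (hdx : d ∈ facialDirections hP hx)
    (hspan : ∀ e ∈ facialDirections hP hx, ∃ c : ℝ, c • d = e) :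
    ∃ v ∈ P.extremePoints ℝ, ∃ w ∈ P.extremePoints ℝ, v ≠ w ∧
      IsExtreme ℝ P (segment ℝ v w) ∧ x ∈ openSegment ℝ v w := by
  have hbot : ∀ {y : E} (hy : y ∈ P), facialDirections hP hy ≤ facialDirections hP hx →
      d ∉ facialDirections hP hy → y ∈ P.extremePoints ℝ := by
    intro y hy hle hdy
    refine mem_extremePoints_of_facialDirections_eq_bot hP hy ((Submodule.eq_bot_iff _).2 ?_)
    intro e he
    obtain ⟨c, rfl⟩ := hspan e (hle he)
    by_contra hne
    exact hdy (((facialDirections hP hy).smul_mem_iff (left_ne_zero_of_smul hne)).1 he)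
  obtain ⟨t, ht, htmax, hw, hwle, hdw⟩ := exists_endpoint hP hPc hx hd hdx
  obtain ⟨s, hs, hsmax, hv, hvle, hdv⟩ :=
    exists_endpoint hP hPc hx (neg_ne_zero.2 hd) ((facialDirections hP hx).neg_mem hdx)
  rw [neg_mem_iff] at hdv
  have hst : s + t ≠ 0 := by positivity
  refine ⟨_, hbot hv hvle hdv, _, hbot hw hwle hdw, ?_, ⟨hP.segment_subset hv hw, ?_⟩, ?_⟩
  · intro h
    have h0 : (s + t) • d = 0 := by
      rw [← sub_eq_zero] at h
      rw [← neg_eq_zero, ← h]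
      module
    exact (smul_ne_zero hst hd) h0
  · intro a ha b hb z hz hzab
    have hzP : z ∈ P := hP.segment_subset hv hw hz
    obtain ⟨p, q, hp, hq, hpq, rfl⟩ := hz
    obtain rfl : p = 1 - q := by linarith
    set r : ℝ := q * t - (1 - q) * s with hr
    have hzr : (1 - q) • (x + s • -d) + q • (x + t • d) = x + r • d := by rw [hr]; module
    have hle : facialDirections hP hzP ≤ facialDirections hP hx := by
      rcases le_total 0 r with h | h
      · refine facialDirections_le hP hx hzP hv (a := s / (s + r)) (b := r / (s + r))
          (by positivity) (by positivity) (by field_simp) ?_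
        rw [hzr]
        match_scalars <;> field_simp
        ring
      · have hr' : 0 < t - r := by linarith
        refine facialDirections_le hP hx hzP hw (a := t / (t - r)) (b := -r / (t - r))
          (by positivity) (div_nonneg (by linarith) hr'.le) (by field_simp; ring) ?_
        rw [hzr]
        match_scalars <;> field_simp <;> ring
    obtain ⟨c, hc⟩ := hspan _ (hle (sub_mem_facialDirections hP hzP ha hb hzab))
    have hac : a = x + (r + c) • d := by
      rw [hzr, eq_sub_iff_add_eq] at hc
      rw [← hc]
      module
    have h₁ : r + c ≤ t := htmax _ (hac ▸ ha)
    have h₂ : -(r + c) ≤ s := hsmax _ (by rwa [smul_neg, neg_smul, neg_neg, ← hac])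
    refine ⟨(t - (r + c)) / (s + t), (s + (r + c)) / (s + t), div_nonneg (by linarith)
      (by positivity), div_nonneg (by linarith) (by positivity), by field_simp; ring, ?_⟩
    rw [hac]
    match_scalars <;> field_simp <;> ring
  · refine ⟨t / (s + t), s / (s + t), by positivity, by positivity, by field_simp; ring, ?_⟩
    match_scalars <;> field_simp <;> ring

/-- If a compact convex set meets the open quadrant `{f > a} ∩ {g > b}`, then so does one of its
extreme points or the interior of one of its edges. -/
theorem exists_extremePoint_or_edge_of_lt [FiniteDimensional ℝ E] {P : Set E} (hP : Convex ℝ P)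
    (hPc : IsCompact P) (f g : E →ₗ[ℝ] ℝ) {a b : ℝ} (h : ∃ x ∈ P, a < f x ∧ b < g x) :
    ∃ x, a < f x ∧ b < g x ∧ (x ∈ P.extremePoints ℝ ∨
      ∃ v ∈ P.extremePoints ℝ, ∃ w ∈ P.extremePoints ℝ, v ≠ w ∧
        IsExtreme ℝ P (segment ℝ v w) ∧ x ∈ openSegment ℝ v w) := by
  obtain ⟨x, hx, hfx, hgx⟩ := h
  induction hk : Module.finrank ℝ (facialDirections hP hx) using Nat.strong_induction_on
    generalizing x with
  | _ k ih =>
  rcases lt_or_ge k 2 with hk2 | hk2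
  · refine ⟨x, hfx, hgx, ?_⟩
    obtain rfl | rfl : k = 0 ∨ k = 1 := by omega
    · exact .inl (mem_extremePoints_of_facialDirections_eq_bot hP hx
        (Submodule.finrank_eq_zero.1 hk))
    · obtain ⟨⟨d, hdx⟩, hd, hspan⟩ := finrank_eq_one_iff'.1 hk
      refine .inr (exists_edge hP hPc hx (fun h => hd (by simpa using h)) hdx fun e he => ?_)
      obtain ⟨c, hc⟩ := hspan ⟨e, he⟩
      exact ⟨c, congrArg Subtype.val hc⟩
  · obtain ⟨d, hdx, hd, hfd, hgd⟩ := exists_nonneg_direction _ (hk2.trans hk.ge) f g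
    obtain ⟨t, ht, -, hy, hle, hdy⟩ := exists_endpoint hP hPc hx hd hdx
    refine ih _ ?_ _ hy ?_ ?_ rfl
    · rw [← hk]
      exact Submodule.finrank_lt_finrank_of_lt (lt_of_le_of_ne hle fun h => hdy (h ▸ hdx))
    · rw [map_add, map_smul, smul_eq_mul]
      nlinarith
    · rw [map_add, map_smul, smul_eq_mul]
      nlinarith

end Compact

/-- If neither endpoint of a segment lies in the open quadrant `{f > a} ∩ {g > b}` but some point
of it does, then the segment starts in `{f > a}` and ends in `{g > b}`, or vice versa, and it
misses `{f ≤ a} ∩ {g ≤ b}`. -/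
theorem segment_crosses_quadrant {E : Type*} [AddCommGroup E] [Module ℝ E] (f g : E →ₗ[ℝ] ℝ)
    {a b : ℝ} {v w x : E} (hx : x ∈ openSegment ℝ v w) (hfx : a < f x) (hgx : b < g x)
    (hv : f v ≤ a ∨ g v ≤ b) (hw : f w ≤ a ∨ g w ≤ b) :
    (a < f v ∧ b < g w ∨ a < f w ∧ b < g v) ∧
      ∀ z ∈ segment ℝ v w, a < f z ∨ b < g z := by
  obtain ⟨p, q, hp, hq, hpq, rfl⟩ := hx
  obtain rfl : p = 1 - q := by linarith
  simp only [map_add, map_smul, smul_eq_mul] at hfx hgx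
  have key : ∀ {α β c : ℝ}, c < (1 - q) * α + q * β → α ≤ c → c < β := by
    intro α β c h₁ h₂
    by_contra! h
    nlinarith
  have key' : ∀ {α β c : ℝ}, c < (1 - q) * α + q * β → β ≤ c → c < α := by
    intro α β c h₁ h₂
    by_contra! h
    nlinarith
  have right : ∀ {α β c r : ℝ}, c < (1 - q) * α + q * β → c < β → q ≤ r → r ≤ 1 →
      c < (1 - r) * α + r * β := by
    intro α β c r h₁ h₂ h₃ h₄
    have : 0 < (1 - r) * ((1 - q) * α + q * β - c) + (r - q) * (β - c) := by
      rcases h₄.lt_or_eq with h | rfl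
      · have := mul_pos (sub_pos.2 h) (sub_pos.2 h₁)
        have := mul_nonneg (sub_nonneg.2 h₃) (sub_pos.2 h₂).le
        linarith
      · have := mul_pos hp (sub_pos.2 h₂)
        linarith
    by_contra! h
    have := mul_nonneg hp.le (sub_nonneg.2 h)
    linarith
  have left : ∀ {α β c r : ℝ}, c < (1 - q) * α + q * β → c < α → r ≤ q → 0 ≤ r →
      c < (1 - r) * α + r * β := by
    intro α β c r h₁ h₂ h₃ h₄
    have : 0 < r * ((1 - q) * α + q * β - c) + (q - r) * (α - c) := by
      rcases h₄.lt_or_eq with h | rfl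
      · have := mul_pos h (sub_pos.2 h₁)
        have := mul_nonneg (sub_nonneg.2 h₃) (sub_pos.2 h₂).le
        linarith
      · have := mul_pos hq (sub_pos.2 h₂)
        linarith
    by_contra! h
    have := mul_nonneg hq.le (sub_nonneg.2 h)
    linarith
  have hends : a < f v ∧ b < g w ∨ a < f w ∧ b < g v := by
    rcases hv with hv | hv
    · have h₁ := key hfx hv
      exact .inr ⟨h₁, key' hgx (hw.resolve_left h₁.not_ge)⟩
    · have h₁ := key hgx hv
      exact .inl ⟨key' hfx (hw.resolve_right h₁.not_ge), h₁⟩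
  refine ⟨hends, ?_⟩
  rintro z ⟨s, r, hs, hr, hsr, rfl⟩
  obtain rfl : s = 1 - r := by linarith
  simp only [map_add, map_smul, smul_eq_mul]
  rcases hends with ⟨h₁, h₂⟩ | ⟨h₁, h₂⟩ <;> rcases le_total q r with h | h
  · exact .inr (right hgx h₂ h (by linarith))
  · exact .inl (left hfx h₁ h hr)
  · exact .inl (right hfx h₁ h (by linarith))
  · exact .inr (left hgx h₂ h hr)


/-- Covering a compact convex polytope `P = convexHull ℝ V` by two closed convex
sets `C₁`, `C₂` is equivalent to: (a) every vertex (extreme point) of `P` lies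
in `C₁` or `C₂`; and (b) every edge `[v, w]` of `P` (a segment between distinct
vertices that is an extreme subset of `P`) with `v ∉ C₁` and `w ∉ C₂` meets
`C₁ ∩ C₂`. -/
theorem polytope_cover_iff_vertices_and_edges {n : ℕ}
    (V : Set (EuclideanSpace ℝ (Fin n))) (hVfin : V.Finite) (hVne : V.Nonempty)
    (C₁ C₂ : Set (EuclideanSpace ℝ (Fin n)))
    (hC₁closed : IsClosed C₁) (hC₁conv : Convex ℝ C₁)
    (hC₂closed : IsClosed C₂) (hC₂conv : Convex ℝ C₂) :
    convexHull ℝ V ⊆ C₁ ∪ C₂ ↔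
      ((∀ v ∈ (convexHull ℝ V).extremePoints ℝ, v ∈ C₁ ∨ v ∈ C₂) ∧
        (∀ v w, v ∈ (convexHull ℝ V).extremePoints ℝ →
          w ∈ (convexHull ℝ V).extremePoints ℝ → v ≠ w →
          IsExtreme ℝ (convexHull ℝ V) (segment ℝ v w) →
          v ∉ C₁ → w ∉ C₂ → (segment ℝ v w ∩ (C₁ ∩ C₂)).Nonempty)) := by
  have hPc : IsCompact (convexHull ℝ V) := hVfin.isCompact_convexHull ℝ
  have hP : Convex ℝ (convexHull ℝ V) := convex_convexHull ℝ V
  constructor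
  · intro h
    refine ⟨fun v hv => h hv.1, fun v w hv hw _ hvw hv₁ hw₂ => ?_⟩
    exact isPreconnected_closed_iff.1 (convex_segment v w).isPreconnected C₁ C₂ hC₁closed hC₂closed
      (hvw.subset.trans h) ⟨w, right_mem_segment ℝ v w, (h hw.1).resolve_right hw₂⟩
      ⟨v, left_mem_segment ℝ v w, (h hv.1).resolve_left hv₁⟩
  · rintro ⟨hvert, hedge⟩ x hx
    by_contra hxC
    rw [Set.mem_union, not_or] at hxC
    obtain ⟨f, a, hfC, hfx⟩ := geometric_hahn_banach_closed_point hC₁conv hC₁closed hxC.1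
    obtain ⟨g, b, hgC, hgx⟩ := geometric_hahn_banach_closed_point hC₂conv hC₂closed hxC.2
    have hvert' : ∀ v ∈ (convexHull ℝ V).extremePoints ℝ, f v ≤ a ∨ g v ≤ b := fun v hv =>
      (hvert v hv).imp (fun h => (hfC v h).le) (fun h => (hgC v h).le)
    obtain ⟨y, hfy, hgy, hy | ⟨v, hv, w, hw, hne, hvw, hy⟩⟩ :=
      exists_extremePoint_or_edge_of_lt hP hPc (f : _ →ₗ[ℝ] ℝ) (g : _ →ₗ[ℝ] ℝ) ⟨x, hx, hfx, hgx⟩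
    · rcases hvert' y hy with h | h
      · exact hfy.not_ge h
      · exact hgy.not_ge h
    · obtain ⟨hends, hmiss⟩ := segment_crosses_quadrant _ _ hy hfy hgy (hvert' v hv) (hvert' w hw)
      have hempty : ¬ (segment ℝ v w ∩ (C₁ ∩ C₂)).Nonempty := by
        rintro ⟨z, hz, hz₁, hz₂⟩
        rcases hmiss z hz with h | h
        · exact (hfC z hz₁).not_gt h
        · exact (hgC z hz₂).not_gt h
      rcases hends with ⟨h₁, h₂⟩ | ⟨h₁, h₂⟩
      · exact hempty (hedge v w hv hw hne hvw (fun h => (hfC v h).not_gt h₁)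
          fun h => (hgC w h).not_gt h₂)
      · rw [segment_symm] at hvw hempty
        exact hempty (hedge w v hw hv hne.symm hvw (fun h => (hfC w h).not_gt h₁)
          fun h => (hgC v h).not_gt h₂)
end
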